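/- Let μ be an uncountable cardinal. There exists a Boolean algebra B satisfying the countable chain condition whose topological density d(B) equals μ. -/

import Mathlib

open Cardinal

/-- `U` is an ultrafilter of the Boolean algebra `B`. -/
def IsUltrafilterOn {B : Type*} [BooleanAlgebra B] (U : Set B) : Prop :=
  ⊥ ∉ U ∧ (∀ a ∈ U, ∀ b ∈ U, a ⊓ b ∈ U) ∧ (∀ a ∈ U, ∀ b : B, a ≤ b → b ∈ U) ∧
    ∀ a : B, a ∈ U ∨ aᶜ ∈ U

/-- The topological density of a Boolean algebra: the least cardinality of a family of
ultrafilters whose union is `B \ {⊥}`. -/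
noncomputable def topDensity (B : Type) [BooleanAlgebra B] : Cardinal :=
  sInf {c : Cardinal | ∃ F : Set (Set B), (∀ U ∈ F, IsUltrafilterOn U) ∧ #F = c ∧
    ∀ a : B, a ≠ ⊥ → ∃ U ∈ F, a ∈ U}

/-- The countable chain condition for a Boolean algebra. -/
def CCC (B : Type*) [BooleanAlgebra B] : Prop :=
  ∀ A : Set B, (∀ a ∈ A, a ≠ ⊥) → A.Pairwise (fun a b => a ⊓ b = ⊥) → A.Countable

namespace CccDensity

/-- Formal requirements on subsets of `I`. The requirement `neg a` asks for disjointness from `a`;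
the requirements `mk f i` and `mk f j` together entail the requirement `f i j`. -/
inductive Gen (I : Type) : Type
  | neg (a : Finset I) : Gen I
  | mk (f : I → I → Gen I) (i : I) : Gen I

namespace Gen

variable {I : Type}

/-- The set of points occurring in a requirement. -/
def supp : Gen I → Set I
  | neg a => ↑a
  | mk f _ => ⋃ i, ⋃ j, supp (f i j)

/-- The nesting depth of a requirement. -/
noncomputable def rank : Gen I → Ordinal.{0}
  | neg _ => 0
  | mk f _ => ⨆ p : I × I, Order.succ (rank (f p.1 p.2))

/-- The indices `i` such that `x` occurs in the `i`-th row or column of `f`. -/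
def lines (f : I → I → Gen I) (x : I) : Set I :=
  {i | ∃ k, x ∈ supp (f i k) ∨ x ∈ supp (f k i)}

/-- Every point occurs in finitely many rows and columns only. -/
def PointFinite (f : I → I → Gen I) : Prop :=
  ∀ x, (lines f x).Finite

/-- A set of requirements closed under entailment. -/
def Closed (T : Set (Gen I)) : Prop :=
  ∀ f i j, PointFinite f → mk f i ∈ T → mk f j ∈ T → f i j ∈ T

theorem supp_mk (f : I → I → Gen I) (i j : I) : supp (mk f i) = supp (mk f j) := by
  simp only [supp]

theorem supp_subset_supp_mk (f : I → I → Gen I) (i j k : I) : supp (f i j) ⊆ supp (mk f k) := by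
  intro x hx
  simp only [supp, Set.mem_iUnion]
  exact ⟨i, j, hx⟩

theorem rank_mk (f : I → I → Gen I) (i j : I) : rank (mk f i) = rank (mk f j) := by
  simp only [rank]

theorem rank_lt_rank_mk (f : I → I → Gen I) (i j k : I) : rank (f i j) < rank (mk f k) := by
  rw [rank]
  exact lt_of_lt_of_le (Order.lt_succ _)
    (Ordinal.le_iSup (fun p : I × I => Order.succ (rank (f p.1 p.2))) (i, j))

/-- The requirement entailed by a pair of requirements. -/
def child : Gen I → Gen I → Gen I
  | mk f i, mk _ j => f i j
  | _, _ => neg ∅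

theorem exists_finite_closed_rank_lt (ρ : Ordinal.{0}) (F : Set (Gen I)) (hF : F.Finite)
    (hρ : ∀ g ∈ F, rank g < ρ) :
    ∃ F' : Set (Gen I), F ⊆ F' ∧ F'.Finite ∧ Closed F' ∧ ∀ g ∈ F', rank g < ρ := by
  induction ρ using WellFoundedLT.induction generalizing F with
  | ind ρ ih =>
    rcases F.eq_empty_or_nonempty with rfl | hne
    · exact ⟨∅, subset_rfl, Set.finite_empty, fun f i j _ h => h.elim, by simp⟩
    obtain ⟨g₀, hg₀, hmax⟩ := Set.exists_max_image F rank hF hne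
    set m := rank g₀
    obtain ⟨F', hsub, hfin, hcl, hlt⟩ := ih m (hρ g₀ hg₀)
      ({g ∈ F | rank g < m} ∪ {g ∈ Set.image2 child F F | rank g < m})
      ((hF.subset (Set.sep_subset _ _)).union ((hF.image2 _ hF).subset (Set.sep_subset _ _)))
      (by rintro g (⟨-, h⟩ | ⟨-, h⟩) <;> exact h)
    refine ⟨F ∪ F', Set.subset_union_left, hF.union hfin, ?_, ?_⟩
    · intro f i j hf hi hj
      right
      rcases hi with hi | hi <;> rcases hj with hj | hj
      · exact hsub (Or.inr ⟨⟨_, hi, _, hj, rfl⟩, (rank_lt_rank_mk f i j i).trans_le (hmax _ hi)⟩)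
      · exact hcl f i j hf (hsub (Or.inl ⟨hi, (rank_mk f i j).trans_lt (hlt _ hj)⟩)) hj
      · exact hcl f i j hf hi (hsub (Or.inl ⟨hj, (rank_mk f j i).trans_lt (hlt _ hi)⟩))
      · exact hcl f i j hf hi hj
    · rintro g (hg | hg)
      · exact hρ g hg
      · exact (hlt g hg).trans (hρ g₀ hg₀)

/-- The least closed set containing `F`. -/
def closure (F : Set (Gen I)) : Set (Gen I) :=
  ⋂₀ {T | Closed T ∧ F ⊆ T}

theorem subset_closure (F : Set (Gen I)) : F ⊆ closure F :=
  Set.subset_sInter fun _ h => h.2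

theorem closed_closure (F : Set (Gen I)) : Closed (closure F) :=
  fun f i j hf hi hj T hT => hT.1 f i j hf (hi T hT) (hj T hT)

theorem closure_subset {F T : Set (Gen I)} (hT : Closed T) (h : F ⊆ T) : closure F ⊆ T :=
  Set.sInter_subset_of_mem ⟨hT, h⟩

theorem finite_closure {F : Set (Gen I)} (hF : F.Finite) : (closure F).Finite := by
  rcases F.eq_empty_or_nonempty with rfl | hne
  · exact Set.finite_empty.subset
      (closure_subset (fun f i j _ h => h.elim) (Set.empty_subset _))
  obtain ⟨g₀, -, hmax⟩ := Set.exists_max_image F rank hF hne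
  obtain ⟨F', hsub, hfin, hcl, -⟩ := exists_finite_closed_rank_lt (Order.succ (rank g₀)) F hF
    fun g hg => Order.lt_succ_of_le (hmax g hg)
  exact hfin.subset (closure_subset hcl hsub)

end Gen

open Gen

/-- A finite condition on a subset of `I`: it contains `pos` and satisfies the requirements
in `gens`. -/
structure Cond (I : Type) where
  pos : Finset I
  gens : Set (Gen I)
  finite : gens.Finite
  closed : Closed gens
  disjoint : ∀ a, Gen.neg a ∈ gens → Disjoint a pos

namespace Cond

variable {I : Type}

/-- Stronger conditions are smaller. -/
instance : Preorder (Cond I) where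
  le p q := q.pos ⊆ p.pos ∧ q.gens ⊆ p.gens
  le_refl p := ⟨subset_rfl, subset_rfl⟩
  le_trans p q r h h' := ⟨h'.1.trans h.1, h'.2.trans h.2⟩

theorem le_def {p q : Cond I} : p ≤ q ↔ q.pos ⊆ p.pos ∧ q.gens ⊆ p.gens := Iff.rfl

/-- The condition with positive part `s` generated by a finite part `F` of a model `T`. -/
def generate (s : Finset I) {T F : Set (Gen I)} (hT : Closed T)
    (hs : ∀ a, Gen.neg a ∈ T → Disjoint a s) (hF : F.Finite) (h : F ⊆ T) : Cond I where
  pos := s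
  gens := closure F
  finite := finite_closure hF
  closed := closed_closure F
  disjoint a ha := hs a (closure_subset hT h ha)

/-- The points and requirements decided by a condition, positively or negatively. -/
def dom (p : Cond I) : Set (I ⊕ Gen I) :=
  Sum.inl '' {x | x ∈ p.pos ∨ ∃ a, Gen.neg a ∈ p.gens ∧ x ∈ a} ∪
    Sum.inr '' {h | h ∈ p.gens ∨ ∃ f i j, h = Gen.mk f j ∧ Gen.mk f i ∈ p.gens ∧ PointFinite f ∧
      ∃ x ∈ p.pos, j ∈ lines f x}

/-- The points and requirements decided positively. -/
def yes (p : Cond I) : Set (I ⊕ Gen I) :=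
  Sum.inl '' (p.pos : Set I) ∪ Sum.inr '' p.gens

theorem yes_subset_dom (p : Cond I) : p.yes ⊆ p.dom :=
  Set.union_subset_union (Set.image_mono fun _ h => Or.inl h) (Set.image_mono fun _ h => Or.inl h)

theorem finite_dom (p : Cond I) : p.dom.Finite := by
  refine (Set.Finite.image _ ?_).union (Set.Finite.image _ ?_)
  · refine p.pos.finite_toSet.union
      ((p.finite.biUnion (t := fun g => match g with | .neg a => (a : Set I) | .mk _ _ => ∅)
        fun g _ => ?_).subset ?_)
    · cases g <;> simp
    · rintro x ⟨a, ha, hx⟩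
      exact Set.mem_biUnion ha hx
  · refine p.finite.union ((p.finite.biUnion (t := fun g => match g with
        | .neg _ => ∅
        | .mk f _ => {h | PointFinite f ∧ h ∈ Gen.mk f '' ⋃ x ∈ p.pos, lines f x})
        fun g _ => ?_).subset ?_)
    · cases g with
      | neg a => simp
      | mk f i =>
        by_cases hf : PointFinite f
        · exact ((p.pos.finite_toSet.biUnion fun x _ => hf x).image _).subset fun h hh => hh.2
        · exact Set.finite_empty.subset fun h hh => hf hh.1
    · rintro _ ⟨f, i, j, rfl, hi, hf, x, hx, hj⟩
      refine Set.mem_biUnion hi ⟨hf, j, ?_, rfl⟩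
      exact Set.mem_biUnion (show x ∈ (p.pos : Set I) from hx) hj

/-- Two conditions make the same decisions wherever both decide. -/
def Agree (p q : Cond I) : Prop :=
  ∀ z ∈ p.dom, z ∈ q.dom → (z ∈ p.yes ↔ z ∈ q.yes)

theorem inl_mem_yes {p : Cond I} {x : I} : Sum.inl x ∈ p.yes ↔ x ∈ p.pos := by
  simp [yes]

theorem inr_mem_yes {p : Cond I} {g : Gen I} : Sum.inr g ∈ p.yes ↔ g ∈ p.gens := by
  simp [yes]

theorem inl_mem_dom {p : Cond I} {x : I} :
    Sum.inl x ∈ p.dom ↔ x ∈ p.pos ∨ ∃ a, Gen.neg a ∈ p.gens ∧ x ∈ a := by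
  simp [dom]

theorem inr_mem_dom {p : Cond I} {h : Gen I} :
    Sum.inr h ∈ p.dom ↔ h ∈ p.gens ∨ ∃ f i j, h = Gen.mk f j ∧ Gen.mk f i ∈ p.gens ∧ PointFinite f ∧
      ∃ x ∈ p.pos, j ∈ lines f x := by
  simp [dom]

/-- The requirements of the members of `Γ`, together with those not mentioning `s`. -/
def amalgam (Γ : Set (Cond I)) (s : Finset I) : Set (Gen I) :=
  {g | (∃ p ∈ Γ, g ∈ p.gens) ∨ Disjoint (supp g) s}

variable {Γ : Set (Cond I)} {s : Finset I}

theorem closed_amalgam (hΓ : ∀ p ∈ Γ, ∀ q ∈ Γ, Agree p q)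
    (hs : ∀ p ∈ Γ, ∀ q ∈ Γ, p ≠ q → ∀ x ∈ s, x ∈ p.pos ∨ x ∈ q.pos) :
    Closed (amalgam Γ s) := by
  intro f i j hf hi hj
  rcases hi with ⟨p, hp, hi⟩ | hi
  · rcases hj with ⟨q, hq, hj⟩ | hj
    · by_cases hd : Disjoint (supp (f i j)) s
      · exact Or.inr hd
      · obtain ⟨x, hx, hxs⟩ := Set.not_disjoint_iff.1 hd
        left
        by_cases hpq : p = q
        · subst hpq
          exact ⟨p, hp, p.closed f i j hf hi hj⟩
        rcases hs p hp q hq hpq x hxs with h | h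
        · have hdom : Sum.inr (Gen.mk f j) ∈ p.dom :=
            inr_mem_dom.2 (Or.inr ⟨f, i, j, rfl, hi, hf, x, h, i, Or.inr hx⟩)
          have := (hΓ p hp q hq _ hdom (yes_subset_dom _ (inr_mem_yes.2 hj))).2 (inr_mem_yes.2 hj)
          exact ⟨p, hp, p.closed f i j hf hi (inr_mem_yes.1 this)⟩
        · have hdom : Sum.inr (Gen.mk f i) ∈ q.dom :=
            inr_mem_dom.2 (Or.inr ⟨f, j, i, rfl, hj, hf, x, h, j, Or.inl hx⟩)
          have := (hΓ q hq p hp _ hdom (yes_subset_dom _ (inr_mem_yes.2 hi))).2 (inr_mem_yes.2 hi)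
          exact ⟨q, hq, q.closed f i j hf (inr_mem_yes.1 this) hj⟩
    · exact Or.inr (hj.mono_left (supp_subset_supp_mk f i j j))
  · exact Or.inr (hi.mono_left (supp_subset_supp_mk f i j i))

theorem disjoint_of_neg_mem_amalgam (hΓ : ∀ p ∈ Γ, ∀ q ∈ Γ, Agree p q)
    (hs : ∀ x ∈ s, ∃ p ∈ Γ, x ∈ p.pos) (a : Finset I) (ha : Gen.neg a ∈ amalgam Γ s) :
    Disjoint a s := by
  rcases ha with ⟨p, hp, ha⟩ | ha
  · refine Finset.disjoint_left.2 fun x hxa hxs => ?_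
    obtain ⟨q, hq, hx⟩ := hs x hxs
    have := (hΓ p hp q hq _ (inl_mem_dom.2 (Or.inr ⟨a, ha, hxa⟩))
      (yes_subset_dom _ (inl_mem_yes.2 hx))).2 (inl_mem_yes.2 hx)
    exact Finset.disjoint_left.1 (p.disjoint a ha) hxa (inl_mem_yes.1 this)
  · exact Finset.disjoint_coe.1 (by simpa [supp] using ha)

/-- Agreeing conditions are compatible. -/
theorem exists_le_of_agree {p q : Cond I} (h : Agree p q) : ∃ r, r ≤ p ∧ r ≤ q := by
  classical
  have hΓ : ∀ p' ∈ ({p, q} : Set (Cond I)), ∀ q' ∈ ({p, q} : Set (Cond I)), Agree p' q' := by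
    have h' : Agree q p := fun z hq hp => (h z hp hq).symm
    rintro _ (rfl | rfl) _ (rfl | rfl)
    exacts [fun _ _ _ => Iff.rfl, h, h', fun _ _ _ => Iff.rfl]
  have hsub : p.gens ∪ q.gens ⊆ amalgam {p, q} (p.pos ∪ q.pos) := by
    rintro g (hg | hg)
    exacts [Or.inl ⟨p, by simp, hg⟩, Or.inl ⟨q, by simp, hg⟩]
  refine ⟨generate (p.pos ∪ q.pos) (closed_amalgam hΓ ?_) (disjoint_of_neg_mem_amalgam hΓ ?_)
    (p.finite.union q.finite) hsub,
    ⟨Finset.subset_union_left, Set.subset_union_left.trans (subset_closure _)⟩,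
    ⟨Finset.subset_union_right, Set.subset_union_right.trans (subset_closure _)⟩⟩
  · rintro _ (rfl | rfl) _ (rfl | rfl) hne x hx <;> simp_all [or_comm]
  · intro x hx
    rcases Finset.mem_union.1 hx with hx | hx
    exacts [⟨p, by simp, hx⟩, ⟨q, by simp, hx⟩]

end Cond

open MeasureTheory in
/-- A family of finite partial functions to `Prop` (with domains `A k` and truth sets `B k`) which
pairwise disagree somewhere on their common domain is countable. -/
theorem countable_of_pairwise_disagree {Ω κ : Type} (A B : κ → Set Ω) (hA : ∀ k, (A k).Finite)
    (K : Set κ) (hK : K.Pairwise fun k l => ¬ ∀ z ∈ A k, z ∈ A l → (z ∈ B k ↔ z ∈ B l)) :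
    K.Countable := by
  classical
  let ν : Measure (Ω → Bool) :=
    Measure.infinitePi fun _ => (PMF.uniformOfFintype Bool).toMeasure
  let C : K → Set (Ω → Bool) := fun k =>
    Set.pi ((hA k).toFinset : Set Ω) fun z => {decide (z ∈ B k)}
  have hmeas : ∀ k, MeasurableSet (C k) := fun k =>
    MeasurableSet.pi (Finset.countable_toSet _) fun z _ => measurableSet_singleton _
  have hdisj : Pairwise (Function.onFun Disjoint C) := by
    intro k l hkl
    refine Set.disjoint_left.2 fun φ hk hl => ?_
    refine hK k.2 l.2 (Subtype.coe_injective.ne hkl) fun z hzk hzl => ?_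
    have h₁ : φ z = decide (z ∈ B k) := hk z (by simpa using hzk)
    have h₂ : φ z = decide (z ∈ B l) := hl z (by simpa using hzl)
    exact decide_eq_decide.1 (h₁.symm.trans h₂)
  have hpos : ∀ k, 0 < ν (C k) := by
    intro k
    rw [Measure.infinitePi_pi _ fun z _ => measurableSet_singleton _, pos_iff_ne_zero,
      Finset.prod_ne_zero_iff]
    intro z _
    rw [PMF.toMeasure_apply_singleton _ _ (measurableSet_singleton _)]
    simp
  have := Measure.countable_meas_pos_of_disjoint_iUnion (μ := ν) hmeas hdisj
  exact Set.countable_univ_iff.1 (this.mono fun k _ => hpos k)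

/-- A set of cardinality at most `2 ^ #M` has a family of `#M` subsets inducing every subset
on each finite set. -/
theorem exists_family_inducing {M Ω : Type} [Infinite M] (h : #Ω ≤ 2 ^ #M) :
    ∃ D : Set (Set Ω), #D ≤ #M ∧
      ∀ A B : Set Ω, A.Finite → ∃ ω ∈ D, ∀ z ∈ A, z ∈ ω ↔ z ∈ B := by
  classical
  rw [← mk_set] at h
  obtain ⟨e⟩ := h
  let W : Finset M × Finset (Finset M) → Set Ω :=
    fun p => {z | ∃ d ∈ p.2, ∀ m ∈ p.1, m ∈ d ↔ m ∈ e z}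
  refine ⟨Set.range W, mk_range_le.trans (by simp), fun A B hA => ?_⟩
  have hsep : ∀ p : Ω × Ω, ∃ m, p.1 ≠ p.2 → ¬ (m ∈ e p.1 ↔ m ∈ e p.2) := by
    intro p
    by_cases hp : p.1 = p.2
    · exact ⟨Classical.arbitrary M, fun h => (h hp).elim⟩
    · by_contra! hcon
      exact hp (e.injective (Set.ext fun m => (hcon m).2))
  choose t ht using hsep
  set P := (hA.toFinset ×ˢ hA.toFinset).image t
  refine ⟨W (P, (hA.toFinset.filter (· ∈ B)).image fun z => P.filter (· ∈ e z)), ⟨_, rfl⟩,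
    fun z hz => ⟨?_, fun hzB => ?_⟩⟩
  · rintro ⟨d, hd, hdz⟩
    obtain ⟨w, hw, rfl⟩ := Finset.mem_image.1 hd
    rw [Finset.mem_filter, Set.Finite.mem_toFinset] at hw
    by_cases hzw : z = w
    · exact hzw ▸ hw.2
    · have hP : t (z, w) ∈ P := Finset.mem_image_of_mem t (by simp [hz, hw.1])
      have h₁ := hdz _ hP
      rw [Finset.mem_filter, and_iff_right hP] at h₁
      exact (ht (z, w) hzw h₁.symm).elim
  · refine ⟨_, Finset.mem_image_of_mem _ (by simpa using ⟨hz, hzB⟩), fun m hm => ?_⟩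
    simp [hm]

/-- The arities of the constructors of `Gen I`. -/
def genArity (I : Type) : Finset I ⊕ I → Type
  | .inl _ => Empty
  | .inr _ => I × I

/-- The tree underlying a requirement. -/
def Gen.toWType {I : Type} : Gen I → WType (genArity I)
  | .neg a => ⟨.inl a, fun e : Empty => e.elim⟩
  | .mk f i => ⟨.inr i, fun p : I × I => (f p.1 p.2).toWType⟩

theorem Gen.toWType_injective {I : Type} : Function.Injective (Gen.toWType (I := I)) := by
  intro g
  induction g with
  | neg a =>
    rintro (b | ⟨f, j⟩) h <;> rw [Gen.toWType, Gen.toWType] at h <;> injection h with h _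
    · rw [Sum.inl.inj h]
    · exact (Sum.inl_ne_inr h).elim
  | mk f i ih =>
    rintro (b | ⟨f', j⟩) h <;> rw [Gen.toWType, Gen.toWType] at h <;> injection h with h h'
    · exact (Sum.inr_ne_inl h).elim
    · obtain rfl := Sum.inr.inj h
      congr 1
      funext k l
      exact ih k l (congrFun h' (k, l))

theorem mk_gen_le (I : Type) [Infinite I] : #(Gen I) ≤ 2 ^ #I := by
  refine (mk_le_of_injective Gen.toWType_injective).trans (WType.cardinalMk_le_of_le ?_)
  have hI := aleph0_le_mk I
  have h2 : ℵ₀ ≤ (2 : Cardinal) ^ #I := hI.trans (cantor _).le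
  calc (Cardinal.sum fun a : Finset I ⊕ I => ((2 : Cardinal) ^ #I) ^ #(genArity I a))
      ≤ Cardinal.sum fun _ : Finset I ⊕ I => (2 : Cardinal) ^ #I := by
        refine sum_le_sum _ _ fun a => ?_
        rcases a with a | i
        · simp only [genArity, mk_eq_zero, power_zero]
          exact one_le_aleph0.trans h2
        · simp only [genArity, mk_prod, lift_id, mul_eq_self hI, ← power_mul]
          exact le_rfl
    _ ≤ 2 ^ #I := by
        rw [sum_const', mk_sum, mk_finset_of_infinite, lift_id, add_eq_self hI]
        exact mul_le_of_le h2 (cantor _).le le_rfl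

open Gen Cond

/-- The regular open algebra of the poset of conditions. -/
abbrev Alg (I : Type) : Type := Heyting.Regular (LowerSet (Cond I))

namespace Alg

variable {I : Type}

theorem exists_mem_of_ne_bot {a : Alg I} (ha : a ≠ ⊥) : ∃ p, p ∈ (a : LowerSet (Cond I)) := by
  by_contra! h
  refine ha (Heyting.Regular.coe_injective ?_)
  rw [Heyting.Regular.coe_bot]
  exact LowerSet.ext (Set.eq_empty_of_forall_notMem h)

theorem ne_bot_of_mem {a : Alg I} {p : Cond I} (h : p ∈ (a : LowerSet (Cond I))) : a ≠ ⊥ := by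
  rintro rfl
  rw [Heyting.Regular.coe_bot] at h
  exact h

theorem inf_ne_bot_of_mem {a b : Alg I} {p : Cond I} (ha : p ∈ (a : LowerSet (Cond I)))
    (hb : p ∈ (b : LowerSet (Cond I))) : a ⊓ b ≠ ⊥ := by
  refine ne_bot_of_mem (p := p) ?_
  rw [Heyting.Regular.coe_inf]
  exact ⟨ha, hb⟩

theorem ccc (I : Type) : CCC (Alg I) := by
  intro A hA hpair
  have h : ∀ a : Alg I, ∃ p : Cond I, a ∈ A → p ∈ (a : LowerSet (Cond I)) := by
    intro a
    by_cases ha : a ∈ A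
    · exact (exists_mem_of_ne_bot (hA a ha)).imp fun p hp _ => hp
    · exact ⟨⟨∅, ∅, Set.finite_empty, fun _ _ _ _ h => h.elim, fun _ h => h.elim⟩,
        fun h => (ha h).elim⟩
  choose p hp using h
  refine countable_of_pairwise_disagree (fun a => (p a).dom) (fun a => (p a).yes)
    (fun a => finite_dom _) A fun a ha b hb hab hagree => ?_
  obtain ⟨r, hra, hrb⟩ := exists_le_of_agree hagree
  exact inf_ne_bot_of_mem ((a : LowerSet (Cond I)).lower hra (hp a ha))
    ((b : LowerSet (Cond I)).lower hrb (hp b hb)) (hpair ha hb hab)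

theorem toRegular_inf (L L' : LowerSet (Cond I)) :
    Heyting.Regular.toRegular (L ⊓ L') =
      Heyting.Regular.toRegular L ⊓ Heyting.Regular.toRegular L' := by
  refine Heyting.Regular.coe_injective ?_
  simp only [Heyting.Regular.coe_inf, Heyting.Regular.coe_toRegular, compl_compl_inf_distrib]

/-- The truth value of `x` belonging to the generic set. -/
def point (x : I) : Alg I :=
  Heyting.Regular.toRegular ⟨{p | x ∈ p.pos}, fun _ _ h hp => h.1 hp⟩

/-- The truth value of the generic set satisfying the requirement `g`. -/
def req (g : Gen I) : Alg I :=
  Heyting.Regular.toRegular ⟨{p | g ∈ p.gens}, fun _ _ h hp => h.2 hp⟩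

theorem mem_point {p : Cond I} {x : I} (h : x ∈ p.pos) : p ∈ (point x : LowerSet (Cond I)) :=
  (le_compl_compl : (⟨{p | x ∈ p.pos}, fun _ _ h hp => h.1 hp⟩ : LowerSet (Cond I)) ≤ _) h

theorem mem_req {p : Cond I} {g : Gen I} (h : g ∈ p.gens) : p ∈ (req g : LowerSet (Cond I)) :=
  (le_compl_compl : (⟨{p | g ∈ p.gens}, fun _ _ h hp => h.2 hp⟩ : LowerSet (Cond I)) ≤ _) h

theorem req_mk_inf_req_mk_le {f : I → I → Gen I} (hf : PointFinite f) (i j : I) :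
    req (.mk f i) ⊓ req (.mk f j) ≤ req (f i j) := by
  rw [req, req, ← toRegular_inf]
  exact Heyting.Regular.toRegular.monotone fun p hp => p.closed f i j hf hp.1 hp.2

theorem req_neg_inf_point {a : Finset I} {x : I} (hx : x ∈ a) : req (.neg a) ⊓ point x = ⊥ := by
  rw [req, point, ← toRegular_inf]
  have : (⟨{p | Gen.neg a ∈ p.gens}, fun _ _ h hp => h.2 hp⟩ : LowerSet (Cond I)) ⊓
      ⟨{p | x ∈ p.pos}, fun _ _ h hp => h.1 hp⟩ = ⊥ :=
    LowerSet.ext (Set.eq_empty_of_forall_notMem fun p hp =>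
      Finset.disjoint_left.1 (p.disjoint a hp.1) hx hp.2)
  rw [this]
  exact Heyting.Regular.coe_injective (by simp)

theorem point_inf_req_ne_bot {x : I} {g : Gen I} (hx : x ∉ supp g) : point x ⊓ req g ≠ ⊥ := by
  have hsub : ({g} : Set (Gen I)) ⊆ amalgam ∅ {x} := by
    rintro _ rfl
    exact Or.inr (by simpa using hx)
  have hdisj : ∀ a, Gen.neg a ∈ amalgam (I := I) ∅ {x} → Disjoint a {x} := by
    rintro a (⟨p, hp, -⟩ | ha)
    · exact hp.elim
    · exact Finset.disjoint_coe.1 (by simpa [supp] using ha)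
  let p : Cond I := generate {x} (closed_amalgam (fun _ h => h.elim) fun _ h => h.elim) hdisj
    (Set.finite_singleton g) hsub
  exact inf_ne_bot_of_mem (p := p) (mem_point (Finset.mem_singleton_self x))
    (mem_req (subset_closure _ rfl))

/-- A downward directed set of conditions generates a filter, which extends to an ultrafilter. -/
theorem exists_ultrafilter (G : Set (Cond I)) (hne : G.Nonempty) (hG : DirectedOn (· ≥ ·) G) :
    ∃ U : Set (Alg I), IsUltrafilterOn U ∧
      ∀ a : Alg I, ∀ p ∈ G, p ∈ (a : LowerSet (Cond I)) → a ∈ U := by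
  have hF : Order.IsPFilter {a : Alg I | ∃ p ∈ G, p ∈ (a : LowerSet (Cond I))} := by
    refine Order.IsPFilter.of_def ?_ ?_ ?_
    · obtain ⟨p, hp⟩ := hne
      exact ⟨⊤, p, hp, by rw [Heyting.Regular.coe_top]; trivial⟩
    · rintro a ⟨p, hp, hpa⟩ b ⟨q, hq, hqb⟩
      obtain ⟨r, hr, hrp, hrq⟩ := hG p hp q hq
      refine ⟨a ⊓ b, ⟨r, hr, ?_⟩, inf_le_left, inf_le_right⟩
      rw [Heyting.Regular.coe_inf]
      exact ⟨(a : LowerSet (Cond I)).lower hrp hpa, (b : LowerSet (Cond I)).lower hrq hqb⟩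
    · rintro a b hab ⟨p, hp, hpa⟩
      exact ⟨p, hp, Heyting.Regular.coe_le_coe.2 hab hpa⟩
  obtain ⟨J, hJ, -, hdisj⟩ := DistribLattice.prime_ideal_of_disjoint_filter_ideal
    (F := hF.toPFilter) (I := (⊥ : Order.Ideal (Alg I))) (by
      refine Set.disjoint_left.2 ?_
      rintro a ⟨p, -, hpa⟩ ha
      exact ne_bot_of_mem hpa (le_bot_iff.1 ha))
  refine ⟨(J : Set (Alg I))ᶜ, ⟨fun h => h J.bot_mem, ?_, ?_, ?_⟩, ?_⟩
  · intro a ha b hb hab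
    exact (hJ.mem_or_mem (SetLike.mem_coe.1 hab)).elim ha hb
  · intro a ha b hab hb
    exact ha (J.lower hab hb)
  · intro a
    by_contra! h
    have h₁ : a ∈ J := by simpa using h.1
    have h₂ : aᶜ ∈ J := by simpa using h.2
    have := J.sup_mem h₁ h₂
    rw [sup_compl_eq_top] at this
    exact hJ.toIsProper.top_notMem this
  · intro a p hp hpa ha
    exact Set.disjoint_left.1 hdisj ⟨p, hp, hpa⟩ ha

/-- The conditions with positive part `s` all of whose decisions agree with `ω`. -/
def coherent (s : Finset I) (ω : Set (I ⊕ Gen I)) : Set (Cond I) :=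
  {p | p.pos = s ∧ ∀ z ∈ p.dom, z ∈ ω ↔ z ∈ p.yes}

theorem exists_ultrafilter_coherent (s : Finset I) (ω : Set (I ⊕ Gen I))
    (hne : (coherent s ω).Nonempty) :
    ∃ U : Set (Alg I), IsUltrafilterOn U ∧
      ∀ a : Alg I, ∀ p ∈ coherent s ω, p ∈ (a : LowerSet (Cond I)) → a ∈ U := by
  have hagree : ∀ p ∈ coherent s ω, ∀ q ∈ coherent s ω, Agree p q :=
    fun p hp q hq z hzp hzq => (hp.2 z hzp).symm.trans (hq.2 z hzq)
  have hcl : Closed (amalgam (coherent s ω) s) :=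
    closed_amalgam hagree fun p hp _ _ _ x hx => Or.inl (hp.1 ▸ hx)
  have hdisj := disjoint_of_neg_mem_amalgam (s := s) hagree
    fun x hx => hne.imp fun p hp => ⟨hp, hp.1 ▸ hx⟩
  let G : Set (Cond I) := {r | r.pos = s ∧ r.gens ⊆ amalgam (coherent s ω) s}
  have hsub : coherent s ω ⊆ G := fun p hp => ⟨hp.1, fun g hg => Or.inl ⟨p, hp, hg⟩⟩
  obtain ⟨U, hU, h⟩ := exists_ultrafilter G (hne.mono hsub) (by
    rintro p ⟨hps, hp⟩ q ⟨hqs, hq⟩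
    refine ⟨generate s hcl hdisj (p.finite.union q.finite) (Set.union_subset hp hq),
      ⟨rfl, closure_subset hcl (Set.union_subset hp hq)⟩,
      ⟨hps.subset, Set.subset_union_left.trans (subset_closure _)⟩,
      ⟨hqs.subset, Set.subset_union_right.trans (subset_closure _)⟩⟩)
  exact ⟨U, hU, fun a p hp => h a p (hsub hp)⟩

theorem exists_covering_family (I : Type) [Infinite I] :
    ∃ F : Set (Set (Alg I)), (∀ U ∈ F, IsUltrafilterOn U) ∧ #F ≤ #I ∧
      ∀ a : Alg I, a ≠ ⊥ → ∃ U ∈ F, a ∈ U := by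
  have hI := aleph0_le_mk I
  have hΩ : #(I ⊕ Gen I) ≤ 2 ^ #I := by
    rw [mk_sum, lift_id, lift_id]
    exact add_le_of_le (hI.trans (cantor _).le) (cantor _).le (mk_gen_le I)
  obtain ⟨D, hD, hind⟩ := exists_family_inducing hΩ
  let K : Set (Finset I × D) := {k | (coherent k.1 k.2.1).Nonempty}
  have hK : ∀ k : K, _ := fun k => exists_ultrafilter_coherent k.1.1 k.1.2.1 k.2
  choose U hU hmem using hK
  refine ⟨Set.range U, ?_, ?_, fun a ha => ?_⟩
  · rintro _ ⟨k, rfl⟩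
    exact hU k
  · refine mk_range_le.trans ((mk_set_le K).trans ?_)
    rw [mk_prod, lift_id, lift_id, mk_finset_of_infinite]
    exact mul_le_of_le hI le_rfl hD
  · obtain ⟨p, hp⟩ := exists_mem_of_ne_bot ha
    obtain ⟨ω, hω, h⟩ := hind p.dom p.yes p.finite_dom
    have hpω : p ∈ coherent p.pos ω := ⟨rfl, h⟩
    exact ⟨_, ⟨⟨(p.pos, ⟨ω, hω⟩), ⟨p, hpω⟩⟩, rfl⟩, hmem ⟨(p.pos, ⟨ω, hω⟩), ⟨p, hpω⟩⟩ a p hpω hp⟩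

end Alg

theorem mk_Iio_toType_ord {c : Cardinal.{0}} (x : c.ord.ToType) : #(Set.Iio x) < c := by
  simpa using mk_Iio_lt x (by simp)

theorem mk_Iic_toType_ord_le {θ : Cardinal.{0}} (hθ : ℵ₀ ≤ θ) (x : (Order.succ θ).ord.ToType) :
    #(Set.Iic x) ≤ θ := by
  have h : #(Set.Iio x) ≤ θ := Order.lt_succ_iff.1 (mk_Iio_toType_ord x)
  rw [← Set.Iio_insert]
  exact mk_insert_le.trans (add_le_of_le hθ h (one_le_aleph0.trans hθ))

/-- For `θ` infinite, there is a matrix on any larger set with values in the well order `θ` which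
exceeds the values of every function somewhere on a fibre. -/
theorem exists_matrix_lt {θ : Cardinal.{0}} (hθ : ℵ₀ ≤ θ) {Ξ : Type} (hΞ : θ < #Ξ) :
    ∃ j : Ξ → Ξ → θ.ord.ToType, ∀ d : Ξ → θ.ord.ToType, ∃ α β, d α = d β ∧ d α < j α β := by
  classical
  let Z : Type := (Order.succ θ).ord.ToType
  have hZ : #Z = Order.succ θ := mk_ord_toType _
  have hM : #θ.ord.ToType = θ := mk_ord_toType _
  have : Infinite θ.ord.ToType := by rwa [infinite_iff, hM]
  obtain ⟨k⟩ : Nonempty (Z ↪ Ξ) := by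
    rw [← Cardinal.le_def, hZ]
    exact Order.succ_le_of_lt hΞ
  have hZne : Nonempty Z := by
    rw [← mk_ne_zero_iff, hZ]
    exact (Order.bot_lt_succ θ).ne'
  have he : ∀ β : Z, Nonempty (Set.Iio β ↪ θ.ord.ToType) := fun β => by
    rw [← Cardinal.le_def, hM]
    exact Order.lt_succ_iff.1 (mk_Iio_toType_ord β)
  let e : ∀ β : Z, Set.Iio β ↪ θ.ord.ToType := fun β => (he β).some
  let j₀ : Z → Z → θ.ord.ToType := fun α β =>
    if h : α < β then e β ⟨α, h⟩ else Classical.arbitrary _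
  refine ⟨fun a b => j₀ (Function.invFun k a) (Function.invFun k b), fun d => ?_⟩
  suffices ∃ α β, d (k α) = d (k β) ∧ d (k α) < j₀ α β by
    obtain ⟨α, β, h, h'⟩ := this
    refine ⟨k α, k β, h, ?_⟩
    beta_reduce
    rwa [Function.leftInverse_invFun k.injective α, Function.leftInverse_invFun k.injective β]
  obtain ⟨ν, hν⟩ := infinite_pigeonhole_card_lt (fun z => d (k z))
    (by rw [hZ, hM]; exact Order.lt_succ θ) (by rw [hZ]; exact hθ.trans (Order.le_succ θ))
  rw [hM] at hν
  obtain ⟨D', hD', hcard⟩ := le_mk_iff_exists_subset.1 hν.le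
  obtain ⟨β, hβ, hlt⟩ : ∃ β, d (k β) = ν ∧ ∀ α ∈ D', α < β := by
    by_contra! h
    refine hν.not_ge ((mk_le_mk_of_subset (t := ⋃ α : D', Set.Iic α.1) ?_).trans ?_)
    · intro β hβ
      obtain ⟨α, hα, hle⟩ := h β hβ
      exact Set.mem_iUnion.2 ⟨⟨α, hα⟩, hle⟩
    · refine (mk_iUnion_le _).trans ?_
      rw [hcard]
      exact mul_le_of_le hθ le_rfl (ciSup_le' fun α => mk_Iic_toType_ord_le hθ _)
  obtain ⟨α, hα, hνα⟩ : ∃ α, ∃ h : α ∈ D', ν < e β ⟨α, hlt α h⟩ := by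
    by_contra! h
    have hinj : Function.Injective fun α : D' =>
        (⟨e β ⟨α.1, hlt α.1 α.2⟩, h α.1 α.2⟩ : Set.Iic ν) := by
      intro α α' hαα
      exact Subtype.ext (congrArg (fun z : Set.Iio β => z.1)
        ((e β).injective (congrArg Subtype.val hαα)))
    have hle := mk_le_of_injective hinj
    rw [hcard, ← Set.Iio_insert] at hle
    exact (hle.trans mk_insert_le).not_gt
      (add_lt_of_lt hθ (mk_Iio_toType_ord ν) (one_lt_aleph0.trans_le hθ))
  have hdα : d (k α) = ν := hD' hα
  refine ⟨α, β, hdα.trans hβ.symm, ?_⟩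
  rw [hdα]
  simpa only [j₀, dif_pos (hlt α hα)] using hνα

/-- Sets `S U` of size greater than `κ`, at most `κ` many of them, have transfinite systems of
representatives of length `κ⁺` which are disjoint at different times and avoid a given point. -/
theorem exists_separated_system {I L : Type} {κ : Cardinal.{0}} (hκ : ℵ₀ ≤ κ) (hL : #L ≤ κ)
    (S : L → Set I) (hS : ∀ U, κ < #(S U)) (x₀ : I) :
    ∃ x : L → (Order.succ κ).ord.ToType → I, (∀ U ξ, x U ξ ∈ S U) ∧ (∀ U ξ, x U ξ ≠ x₀) ∧
      ∀ U U' ξ ξ', x U ξ = x U' ξ' → ξ = ξ' := by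
  have hpick : ∀ (A : Set I) (U : L), ∃ y, #A ≤ κ → y ∈ S U ∧ y ∉ A := by
    intro A U
    by_cases hA : #A ≤ κ
    · obtain ⟨y, hy, hyA⟩ := Set.not_subset.1 fun h : S U ⊆ A =>
        ((mk_le_mk_of_subset h).trans hA).not_gt (hS U)
      exact ⟨y, fun _ => ⟨hy, hyA⟩⟩
    · exact ⟨x₀, fun h => (hA h).elim⟩
  choose pick hpick using hpick
  let step : ∀ ξ : (Order.succ κ).ord.ToType, (∀ η, η < ξ → L → I) → L → I := fun ξ rec U =>
    pick (insert x₀ (Set.range fun p : Set.Iio ξ × L => rec p.1.1 p.1.2 p.2)) U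
  let x : (Order.succ κ).ord.ToType → L → I := wellFounded_lt.fix step
  have hx : ∀ ξ U, x ξ U ∈ S U ∧ x ξ U ∉ insert x₀
      (Set.range fun p : Set.Iio ξ × L => x p.1 p.2) := by
    intro ξ U
    have h : x ξ U = pick (insert x₀ (Set.range fun p : Set.Iio ξ × L => x p.1 p.2)) U :=
      congrFun (wellFounded_lt.fix_eq step ξ) U
    rw [h]
    refine hpick _ U (mk_insert_le.trans (add_le_of_le hκ (mk_range_le.trans ?_)
      (one_le_aleph0.trans hκ)))
    rw [mk_prod, lift_id, lift_id]
    exact mul_le_of_le hκ (Order.lt_succ_iff.1 (mk_Iio_toType_ord ξ)) hL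
  have hne : ∀ U U' ξ ξ', ξ' < ξ → x ξ U ≠ x ξ' U' := fun U U' ξ ξ' h heq =>
    (hx ξ U).2 (Or.inr ⟨(⟨ξ', h⟩, U'), heq.symm⟩)
  refine ⟨fun U ξ => x ξ U, fun U ξ => (hx ξ U).1, fun U ξ h => (hx ξ U).2 (Or.inl h),
    fun U U' ξ ξ' h => ?_⟩
  rcases lt_trichotomy ξ ξ' with hlt | heq | hlt
  · exact (hne U' U ξ' ξ hlt h.symm).elim
  · exact heq
  · exact (hne U U' ξ ξ' hlt h).elim

/-- Fewer than `#Ξ` closed sets of requirements, each satisfied by one row of a separated system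
of length `Ξ`, omit a common requirement which only mentions points of the system. -/
theorem exists_requirement_notMem {I L Ξ : Type} [Infinite Ξ] (ε : Ξ ↪ I) (S : L → Set I)
    (T : L → Set (Gen I)) (hT : ∀ U, Closed (T U))
    (hST : ∀ U a, Gen.neg a ∈ T U → ∀ x ∈ a, x ∉ S U) (x : L → Ξ → I) (hxS : ∀ U ξ, x U ξ ∈ S U)
    (hx : ∀ U U' ξ ξ', x U ξ = x U' ξ' → ξ = ξ') (θ : Cardinal.{0}) (hθ : θ < #Ξ) (N : Type)
    (hN : #N = θ) (u : N → L) (ι : Ξ ↪ Ξ) :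
    ∃ g : Gen I, (∀ y ∈ supp g, ∃ U ξ, y = x U (ι ξ)) ∧ ∀ n, g ∉ T (u n) := by
  classical
  induction θ using WellFoundedLT.induction generalizing N ι with
  | ind θ ih =>
    rcases finite_or_infinite N with hfin | hinf
    · have := Fintype.ofFinite N
      have ξ₀ : Ξ := Classical.arbitrary Ξ
      refine ⟨.neg (Finset.univ.image fun n => x (u n) (ι ξ₀)), ?_, fun n hn => ?_⟩
      · intro y hy
        obtain ⟨n, -, rfl⟩ := Finset.mem_image.1 (show y ∈ Finset.image _ _ from hy)
        exact ⟨_, _, rfl⟩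
      · exact hST _ _ hn _ (Finset.mem_image_of_mem _ (Finset.mem_univ n)) (hxS _ _)
    have hθ₀ : ℵ₀ ≤ θ := hN ▸ aleph0_le_mk N
    obtain ⟨h⟩ : Nonempty (N ≃ θ.ord.ToType) := by
      rw [← Cardinal.eq, mk_ord_toType, hN]
    obtain ⟨j, hj⟩ := exists_matrix_lt hθ₀ hθ
    obtain ⟨π⟩ : Nonempty (Ξ × Ξ × Ξ ↪ Ξ) := by
      rw [← Cardinal.le_def]
      simp [mul_eq_self (aleph0_le_mk Ξ)]
    have hF : ∀ α β, ∃ g : Gen I, (∀ y ∈ supp g, ∃ U ξ, y = x U (ι (π (α, β, ξ)))) ∧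
        ∀ n < j α β, g ∉ T (u (h.symm n)) := by
      intro α β
      obtain ⟨g, hg, hgT⟩ := ih _ (mk_Iio_toType_ord (j α β)) ((mk_Iio_toType_ord _).trans hθ)
        (Set.Iio (j α β)) rfl (fun n => u (h.symm n))
        ⟨fun ξ => ι (π (α, β, ξ)), fun ξ ξ' hξ => by simpa using hξ⟩
      exact ⟨g, hg, fun n hn => hgT ⟨n, hn⟩⟩
    choose F hFsupp hFT using hF
    let ε₂ : Ξ × Ξ → I × I := Prod.map ε ε
    have hε₂ : Function.Injective ε₂ := ε.injective.prodMap ε.injective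
    let f : I → I → Gen I := fun i k =>
      Function.extend ε₂ (fun p => F p.1 p.2) (fun _ => .neg ∅) (i, k)
    have hf : ∀ α β, f (ε α) (ε β) = F α β := fun α β =>
      hε₂.extend_apply (fun p => F p.1 p.2) (fun _ => .neg ∅) (α, β)
    have hfsupp : ∀ i k, ∀ y ∈ supp (f i k), ∃ α β, i = ε α ∧ k = ε β ∧ y ∈ supp (F α β) := by
      intro i k y hy
      by_cases hik : ∃ p, ε₂ p = (i, k)
      · obtain ⟨⟨α, β⟩, hp⟩ := hik
        obtain ⟨rfl, rfl⟩ := Prod.mk.inj hp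
        exact ⟨α, β, rfl, rfl, hf α β ▸ hy⟩
      · simp only [f, Function.extend_apply' _ _ _ hik, supp] at hy
        simp at hy
    have huniq : ∀ y α β α' β', y ∈ supp (F α β) → y ∈ supp (F α' β') → α = α' ∧ β = β' := by
      intro y α β α' β' hy hy'
      obtain ⟨U, ξ, rfl⟩ := hFsupp α β y hy
      obtain ⟨U', ξ', h'⟩ := hFsupp α' β' _ hy'
      have := π.injective (ι.injective (hx _ _ _ _ h'))
      simp only [Prod.mk.injEq] at this
      exact ⟨this.1, this.2.1⟩
    have hfin : PointFinite f := by
      intro y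
      by_cases hy : ∃ α β, y ∈ supp (F α β)
      · obtain ⟨α, β, hαβ⟩ := hy
        refine (Set.toFinite {ε α, ε β}).subset ?_
        rintro i ⟨k, hk | hk⟩ <;> obtain ⟨α', β', rfl, rfl, h'⟩ := hfsupp _ _ y hk <;>
          obtain ⟨rfl, rfl⟩ := huniq y _ _ _ _ hαβ h' <;> simp
      · refine Set.finite_empty.subset ?_
        rintro i ⟨k, hk | hk⟩ <;> obtain ⟨α', β', -, -, h'⟩ := hfsupp _ _ y hk <;>
          exact hy ⟨_, _, h'⟩
    by_contra! hcon
    have hd : ∀ α, ∃ n, Gen.mk f (ε α) ∈ T (u n) := by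
      refine fun α => hcon _ fun y hy => ?_
      simp only [supp, Set.mem_iUnion] at hy
      obtain ⟨i, k, hy⟩ := hy
      obtain ⟨α', β', -, -, h'⟩ := hfsupp i k y hy
      obtain ⟨U, ξ, hU⟩ := hFsupp _ _ y h'
      exact ⟨U, _, hU⟩
    choose d hd using hd
    obtain ⟨α, β, heq, hlt⟩ := hj fun α => h (d α)
    have hdeq : d α = d β := h.injective heq
    refine hFT α β _ hlt ?_
    rw [h.symm_apply_apply, ← hf]
    exact hT _ f _ _ hfin (hd α) (hdeq ▸ hd β)

namespace Alg

variable {I : Type}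

theorem closed_of_isUltrafilterOn {U : Set (Alg I)} (hU : IsUltrafilterOn U) :
    Closed {g | req g ∈ U} :=
  fun _ i j hf hi hj => hU.2.2.1 _ (hU.2.1 _ hi _ hj) _ (req_mk_inf_req_mk_le hf i j)

theorem point_notMem_of_req_neg_mem {U : Set (Alg I)} (hU : IsUltrafilterOn U) {a : Finset I}
    (ha : req (.neg a) ∈ U) {x : I} (hx : x ∈ a) : point x ∉ U := by
  intro h
  exact hU.1 (hU.2.2.1 _ (hU.2.1 _ ha _ h) _ (req_neg_inf_point hx).le)

/-- A covering family of ultrafilters has at least `#I` members. -/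
theorem mk_le_of_covering (hI : ℵ₀ < #I) (F : Set (Set (Alg I)))
    (hF : ∀ U ∈ F, IsUltrafilterOn U) (hcov : ∀ a : Alg I, a ≠ ⊥ → ∃ U ∈ F, a ∈ U) :
    #I ≤ #F := by
  by_contra! hlt
  set κ := max #F ℵ₀
  have hκ : ℵ₀ ≤ κ := le_max_right _ _
  have hFκ : #F ≤ κ := le_max_left _ _
  have hκI : κ < #I := max_lt hlt hI
  let S : F → Set I := fun U => {x | point x ∈ U.1}
  let small : Set I := ⋃ U : {U : F // #(S U) ≤ κ}, S U.1
  have hsmall : #small ≤ κ := by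
    refine (mk_iUnion_le _).trans (mul_le_of_le hκ ((mk_subtype_le _).trans hFκ) ?_)
    exact ciSup_le' fun U => U.2
  obtain ⟨x₀, hx₀⟩ : ∃ x₀, x₀ ∉ small := by
    by_contra! h
    rw [Set.eq_univ_of_forall h, mk_univ] at hsmall
    exact hsmall.not_gt hκI
  let L : Type := {U : F // κ < #(S U)}
  have hL : #L ≤ κ := (mk_subtype_le _).trans hFκ
  obtain ⟨x, hxS, hxx₀, hx⟩ := exists_separated_system hκ hL (fun U : L => S U.1) (fun U => U.2) x₀
  have hΞ : #(Order.succ κ).ord.ToType = Order.succ κ := mk_ord_toType _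
  have : Infinite (Order.succ κ).ord.ToType := by
    rw [infinite_iff, hΞ]
    exact hκ.trans (Order.le_succ κ)
  obtain ⟨ε⟩ : Nonempty ((Order.succ κ).ord.ToType ↪ I) := by
    rw [← Cardinal.le_def, hΞ]
    exact Order.succ_le_of_lt hκI
  obtain ⟨g, hg, hgT⟩ := exists_requirement_notMem ε (fun U : L => S U.1)
    (fun U => {g | req g ∈ U.1.1}) (fun U => closed_of_isUltrafilterOn (hF _ U.1.2))
    (fun U a ha y hy => point_notMem_of_req_neg_mem (hF _ U.1.2) ha hy) x hxS hx #L
    (by rw [hΞ]; exact Order.lt_succ_of_le hL) L rfl id (Function.Embedding.refl _)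
  have hx₀g : x₀ ∉ supp g := by
    intro h
    obtain ⟨U, ξ, h⟩ := hg x₀ h
    exact hxx₀ _ _ h.symm
  obtain ⟨U, hU, hmem⟩ := hcov _ (point_inf_req_ne_bot hx₀g)
  have hx₀U : point x₀ ∈ U := (hF U hU).2.2.1 _ hmem _ inf_le_left
  have hgU : req g ∈ U := (hF U hU).2.2.1 _ hmem _ inf_le_right
  have hlarge : κ < #(S ⟨U, hU⟩) := by
    by_contra! h
    exact hx₀ (Set.mem_iUnion.2 ⟨⟨⟨U, hU⟩, h⟩, hx₀U⟩)
  exact hgT ⟨⟨U, hU⟩, hlarge⟩ hgU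

theorem topDensity_eq (hI : ℵ₀ < #I) : topDensity (Alg I) = #I := by
  have : Infinite I := infinite_iff.2 hI.le
  obtain ⟨F, hF, hcard, hcov⟩ := exists_covering_family I
  rw [topDensity]
  refine le_antisymm (le_trans (csInf_le' (a := #F) ?_) hcard) ?_
  · exact ⟨F, hF, rfl, hcov⟩
  refine le_csInf ⟨_, F, hF, rfl, hcov⟩ ?_
  rintro c ⟨F', hF', rfl, hcov'⟩
  exact mk_le_of_covering hI F' hF' hcov'

end Alg

end CccDensity

/-- Main theorem: for every uncountable cardinal μ there is a ccc Boolean algebra whose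
topological density is exactly μ. -/
theorem exists_ccc_boolean_algebra_with_density (μ : Cardinal.{0}) (hμ : ℵ₀ < μ) :
    ∃ (B : Type) (inst : BooleanAlgebra B), @CCC B inst ∧ @topDensity B inst = μ :=
  ⟨CccDensity.Alg μ.out, inferInstance, CccDensity.Alg.ccc _, by
    rw [CccDensity.Alg.topDensity_eq (by rwa [mk_out]), mk_out]⟩
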